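/- Let y ∈ ℝ^d and let y_(1) ≥ y_(2) ≥ … ≥ y_(d) denote the components of y sorted in decreasing order. Let m be the largest index in {1,…,d} such that y_(m) − (1/m)·(∑_{j=1}^m y_(j) − 1) > 0, and set λ = (1/m)·(∑_{j=1}^m y_(j) − 1). Then the vector x* ∈ ℝ^d defined by x*ᵢ = max(yᵢ − λ, 0) belongs to Δ and is the unique minimizer of x ↦ ‖x − y‖² over Δ. -/

import Mathlib

noncomputable section

/-- the standard simplex `Δ`. -/
def simplexSet (d : ℕ) : Set (EuclideanSpace ℝ (Fin d)) :=
  {x | (∀ i, 0 ≤ x i) ∧ ∑ i, x i = 1}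

/-- the closed-form Euclidean projection of `y` onto the simplex. The sorted
components `y_(1) ≥ … ≥ y_(d)` are encoded via a permutation `σ` making `j ↦ y (σ j)`
antitone; `m` is the largest index with `y_(m) − (1/m)(∑_{j≤m} y_(j) − 1) > 0` and
`λ = (1/m)(∑_{j≤m} y_(j) − 1)`. Then `x*ᵢ = max(yᵢ − λ, 0)` lies in `Δ` and is the unique
minimizer of `x ↦ ‖x − y‖²` over `Δ`. -/
theorem stmt14 (d : ℕ) (hd : 1 ≤ d) (y : EuclideanSpace ℝ (Fin d))
    (σ : Equiv.Perm (Fin d)) (hσ : Antitone fun j => y (σ j))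
    (m : ℕ) (hm1 : 1 ≤ m) (hmd : m ≤ d)
    (hcond : ∀ j : Fin d, (j : ℕ) + 1 = m →
      0 < y (σ j) - (1 / (m : ℝ)) *
        ((∑ i ∈ Finset.univ.filter fun i : Fin d => (i : ℕ) < m, y (σ i)) - 1))
    (hlargest : ∀ k : ℕ, m < k → k ≤ d → ∀ j : Fin d, (j : ℕ) + 1 = k →
      ¬ (0 < y (σ j) - (1 / (k : ℝ)) *
        ((∑ i ∈ Finset.univ.filter fun i : Fin d => (i : ℕ) < k, y (σ i)) - 1)))
    (lam : ℝ)
    (hlam : lam = (1 / (m : ℝ)) *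
      ((∑ i ∈ Finset.univ.filter fun i : Fin d => (i : ℕ) < m, y (σ i)) - 1))
    (xstar : EuclideanSpace ℝ (Fin d)) (hxstar : ∀ i, xstar i = max (y i - lam) 0) :
    xstar ∈ simplexSet d
      ∧ (∀ x ∈ simplexSet d, ‖xstar - y‖ ^ 2 ≤ ‖x - y‖ ^ 2)
      ∧ ∀ x ∈ simplexSet d, x ≠ xstar → ‖xstar - y‖ ^ 2 < ‖x - y‖ ^ 2 := by
  have hm0 : (0:ℝ) < m := by exact_mod_cast hm1
  have hmlam : (m:ℝ) * lam =
      (∑ i ∈ Finset.univ.filter fun i : Fin d => (i : ℕ) < m, y (σ i)) - 1 := by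
    rw [hlam]; field_simp
  have hbig : ∀ j : Fin d, (j:ℕ) < m → lam < y (σ j) := by
    intro j hj
    have h1 := hcond ⟨m - 1, by omega⟩ (by simp; omega)
    rw [← hlam] at h1
    have h2 : y (σ ⟨m - 1, by omega⟩) ≤ y (σ j) :=
      hσ (show j ≤ ⟨m - 1, by omega⟩ by rw [Fin.le_def]; simp; omega)
    linarith
  have hsmall : ∀ j : Fin d, m ≤ (j:ℕ) → y (σ j) ≤ lam := by
    intro j hj
    have hjd := j.2
    have hmd' : m < d := by omega
    have h1 := hlargest (m + 1) (by omega) (by omega) ⟨m, hmd'⟩ rfl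
    have h2 : y (σ j) ≤ y (σ ⟨m, hmd'⟩) :=
      hσ (show (⟨m, hmd'⟩ : Fin d) ≤ j by rw [Fin.le_def]; simpa using hj)
    have h3 : (Finset.univ.filter fun i : Fin d => (i : ℕ) < m + 1)
        = insert (⟨m, hmd'⟩ : Fin d) (Finset.univ.filter fun i : Fin d => (i : ℕ) < m) := by
      ext i
      simp [Fin.ext_iff]
      omega
    rw [h3, Finset.sum_insert (by simp), add_sub_assoc, ← hmlam, not_lt, sub_nonpos,
      one_div, inv_mul_eq_div, le_div_iff₀ (by positivity)] at h1
    push_cast at h1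
    have h4 : (m:ℝ) * y (σ ⟨m, hmd'⟩) ≤ m * lam := by linarith
    have h5 := le_of_mul_le_mul_left h4 hm0
    linarith
  have hcard : (Finset.univ.filter fun i : Fin d => (i : ℕ) < m).card = m := by
    rw [Fin.card_filter_val_lt]; omega
  have hmem : xstar ∈ simplexSet d := by
    refine ⟨fun i => by rw [hxstar]; exact le_max_right _ _, ?_⟩
    rw [← Equiv.sum_comp σ]
    have h1 : ∀ j, xstar (σ j) = if (j:ℕ) < m then y (σ j) - lam else 0 := by
      intro j
      rw [hxstar]
      split_ifs with h
      · exact max_eq_left (by linarith [hbig j h])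
      · exact max_eq_right (by linarith [hsmall j (by omega)])
    simp_rw [h1]
    rw [← Finset.sum_filter, Finset.sum_sub_distrib, Finset.sum_const, hcard, nsmul_eq_mul, hmlam]
    ring
  have key : ∀ x ∈ simplexSet d, ‖xstar - y‖ ^ 2 + ‖x - xstar‖ ^ 2 ≤ ‖x - y‖ ^ 2 := by
    intro x hx
    have hp : ∀ i, (xstar i - y i) ^ 2 + (x i - xstar i) ^ 2 - 2 * lam * (x i - xstar i)
        ≤ (x i - y i) ^ 2 := by
      intro i
      have h0 := hx.1 i
      rw [hxstar]
      rcases le_total (y i - lam) 0 with h | h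
      · rw [max_eq_right h]
        nlinarith [mul_nonneg h0 (neg_nonneg.2 h)]
      · rw [max_eq_left h]
        nlinarith
    have hs := Finset.sum_le_sum fun i (_ : i ∈ Finset.univ) => hp i
    rw [Finset.sum_sub_distrib, Finset.sum_add_distrib, ← Finset.mul_sum,
      Finset.sum_sub_distrib, hx.2, hmem.2] at hs
    simp only [EuclideanSpace.norm_sq_eq, Real.norm_eq_abs, sq_abs, PiLp.sub_apply]
    linarith
  refine ⟨hmem, fun x hx => ?_, fun x hx hne => ?_⟩
  · have := key x hx
    have := sq_nonneg ‖x - xstar‖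
    linarith
  · have := key x hx
    have : 0 < ‖x - xstar‖ ^ 2 := pow_pos (norm_pos_iff.2 (sub_ne_zero.2 hne)) 2
    linarith
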